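/- Let F be a cumulative distribution function on ℝ with finite k-th absolute moment for some k > 1. Then the residual distribution F̃ of F has finite (k−1)-st absolute moment. -/

import Mathlib

open MeasureTheory ProbabilityTheory Set Filter Topology Asymptotics

noncomputable section

/-- Generalized inverse `F⁻¹` of the CDF of the distribution `ν`:
`F⁻¹(t) = inf {x | F(x) ≥ t}` for `t ≠ 0` and `F⁻¹(0) = inf {x | F(x) > 0}`. -/
def qf (ν : Measure ℝ) (t : ℝ) : ℝ :=
  if t = 0 then sInf {x : ℝ | 0 < (ν (Iic x)).toReal}
  else sInf {x : ℝ | t ≤ (ν (Iic x)).toReal}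

/-- `H(s) = ∫₀ˢ (F⁻¹(t) − μ) dt`. -/
def Hfun (ν : Measure ℝ) (μ : ℝ) (s : ℝ) : ℝ := ∫ t in (0:ℝ)..s, (qf ν t - μ)

/-- `ν = F(μ−)`. -/
def nuM (ν : Measure ℝ) (μ : ℝ) : ℝ := (ν (Iio μ)).toReal

/-- `ν⁺ = F(μ)`. -/
def nuP (ν : Measure ℝ) (μ : ℝ) : ℝ := (ν (Iic μ)).toReal

/-- `c = H(ν)`, the minimum value of `H`. -/
def cval (ν : Measure ℝ) (μ : ℝ) : ℝ := Hfun ν μ (nuM ν μ)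

/-- `A : [c,0] → [0,ν]`, the inverse of `H` on `[0,ν)`, with `A(c) = ν⁺`. -/
def Afun (ν : Measure ℝ) (μ : ℝ) (s : ℝ) : ℝ :=
  if s = cval ν μ then nuP ν μ
  else sInf {t : ℝ | t ∈ Icc 0 (nuM ν μ) ∧ Hfun ν μ t ≤ s}

/-- `B : [c,0] → [ν⁺,1]`, the inverse of `H` on `(ν⁺,1]`, with `B(c) = ν⁺`. -/
def Bfun (ν : Measure ℝ) (μ : ℝ) (s : ℝ) : ℝ :=
  if s = cval ν μ then nuP ν μ
  else sInf {t : ℝ | t ∈ Icc (nuP ν μ) 1 ∧ s ≤ Hfun ν μ t}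

/-- The distribution function `K`, supported on `[c,0]`. -/
def Kfun (ν : Measure ℝ) (μ : ℝ) (s : ℝ) : ℝ :=
  if 0 < s then 1
  else if s < cval ν μ then 0
  else if s = cval ν μ then nuP ν μ - nuM ν μ
  else Bfun ν μ s - Afun ν μ s

/-- `u(s) = (μ − F⁻¹(A(s))) / (F⁻¹(B(s)) − F⁻¹(A(s)))` for `s ∈ (c,0)`, `u(c) = 1/2`. -/
def ufun (ν : Measure ℝ) (μ : ℝ) (s : ℝ) : ℝ :=
  if s = cval ν μ then 1/2
  else (μ - qf ν (Afun ν μ s)) / (qf ν (Bfun ν μ s) - qf ν (Afun ν μ s))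

/-- Generalized inverse of the distribution function `K`. -/
def Kinv (ν : Measure ℝ) (μ : ℝ) (t : ℝ) : ℝ := sInf {s : ℝ | t ≤ Kfun ν μ s}

/-- The map `t ↦ F⁻¹(B(Y(t))) − F⁻¹(A(Y(t)))` where `Y = K⁻¹` is the quantile
transform of `K`; applied to a uniform random variable it realizes the residual
distribution of `F`. -/
def residualRV (ν : Measure ℝ) (μ : ℝ) (t : ℝ) : ℝ :=
  qf ν (Bfun ν μ (Kinv ν μ t)) - qf ν (Afun ν μ (Kinv ν μ t))

/-- The residual distribution `F̃` of `F`: the law of `F⁻¹(B(Y)) − F⁻¹(A(Y))`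
for `Y ∼ K`. -/
def residualDist (ν : Measure ℝ) (μ : ℝ) : Measure ℝ :=
  Measure.map (residualRV ν μ) (volume.restrict (Icc (0:ℝ) 1))

end

section Quantile

variable {ν : Measure ℝ} [IsProbabilityMeasure ν]

lemma toReal_Iic_mono {x y : ℝ} (h : x ≤ y) : (ν (Iic x)).toReal ≤ (ν (Iic y)).toReal :=
  measureReal_mono (Iic_subset_Iic.2 h)

lemma qf_le_iff {t y : ℝ} (h0 : 0 < t) (h1 : t < 1) :
    qf ν t ≤ y ↔ t ≤ (ν (Iic y)).toReal := by
  have hF : ∀ x, (ν (Iic x)).toReal = cdf ν x := fun x => (cdf_eq_real ν x).symm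
  simp only [qf, if_neg h0.ne', hF]
  set S := {x : ℝ | t ≤ cdf ν x}
  have hne : S.Nonempty := ((tendsto_cdf_atTop ν).eventually_const_le h1).exists
  have hbdd : BddBelow S := by
    obtain ⟨b, hb⟩ := ((tendsto_cdf_atBot ν).eventually_lt_const h0).exists
    refine ⟨b, fun x hx => ?_⟩
    by_contra! hxb
    exact absurd hx (not_le.2 ((monotone_cdf ν hxb.le).trans_lt hb))
  have hlt : ∀ x, sInf S < x → t ≤ cdf ν x := fun x hx => by
    obtain ⟨z, hz, hzx⟩ := exists_lt_of_csInf_lt hne hx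
    exact le_trans hz (monotone_cdf ν hzx.le)
  have hmem : t ≤ cdf ν (sInf S) := by
    have hcont : Tendsto (cdf ν) (𝓝[>] sInf S) (𝓝 (cdf ν (sInf S))) :=
      ((cdf ν).right_continuous (sInf S)).mono_left (nhdsWithin_mono _ Ioi_subset_Ici_self)
    exact ge_of_tendsto hcont (eventually_mem_nhdsWithin.mono hlt)
  exact ⟨fun h => hmem.trans (monotone_cdf ν h), fun h => csInf_le hbdd h⟩

lemma qf_monotoneOn : MonotoneOn (qf ν) (Ioo 0 1) := fun _ hs _ ht hst =>
  (qf_le_iff hs.1 hs.2).2 (hst.trans ((qf_le_iff ht.1 ht.2).1 le_rfl))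

lemma aemeasurable_qf : AEMeasurable (qf ν) (volume.restrict (Ioo 0 1)) :=
  aemeasurable_restrict_of_monotoneOn measurableSet_Ioo qf_monotoneOn

lemma map_qf : Measure.map (qf ν) (volume.restrict (Ioo 0 1)) = ν := by
  symm
  refine Measure.ext_of_Iic _ _ fun y => ?_
  have h1 : (ν (Iic y)).toReal ≤ 1 := measureReal_le_one
  rw [Measure.map_apply_of_aemeasurable aemeasurable_qf measurableSet_Iic,
    Measure.restrict_apply' measurableSet_Ioo]
  have hset : qf ν ⁻¹' Iic y ∩ Ioo 0 1 = Ioc 0 (ν (Iic y)).toReal ∩ Iio 1 := by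
    ext t
    simp only [mem_inter_iff, mem_preimage, mem_Iic, mem_Ioo, mem_Ioc, mem_Iio]
    constructor
    · rintro ⟨h, h0, h1⟩
      exact ⟨⟨h0, (qf_le_iff h0 h1).1 h⟩, h1⟩
    · rintro ⟨⟨h0, h⟩, h1⟩
      exact ⟨(qf_le_iff h0 h1).2 h, h0, h1⟩
  have hae : (Ioc 0 (ν (Iic y)).toReal ∩ Iio 1 : Set ℝ) =ᵐ[volume] Ioc 0 (ν (Iic y)).toReal := by
    have h := (ae_eq_refl (μ := volume) (Ioc 0 (ν (Iic y)).toReal)).inter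
      (Iio_ae_eq_Iic (a := (1 : ℝ)))
    have hsub : Ioc 0 (ν (Iic y)).toReal ⊆ Iic 1 := fun t ht => ht.2.trans h1
    exact h.trans (inter_eq_left.2 hsub).eventuallyEq
  rw [hset, measure_congr hae, Real.volume_Ioc, sub_zero, ENNReal.ofReal_toReal (measure_ne_top _ _)]

lemma intervalIntegrable_qf_sub (hint : Integrable id ν) (μ : ℝ) :
    IntervalIntegrable (fun t => qf ν t - μ) volume 0 1 := by
  rw [intervalIntegrable_iff_integrableOn_Ioo_of_le zero_le_one]
  have h : Integrable (id ∘ qf ν) (volume.restrict (Ioo 0 1)) := by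
    rw [← integrable_map_measure (by rw [map_qf]; exact hint.1) aemeasurable_qf, map_qf]
    exact hint
  exact h.sub (integrable_const μ)

lemma Hfun_one (hint : Integrable id ν) {μ : ℝ} (hμ : μ = ∫ x, x ∂ν) : Hfun ν μ 1 = 0 := by
  have h : ∫ x, (x - μ) ∂(Measure.map (qf ν) (volume.restrict (Ioo 0 1))) = 0 := by
    rw [map_qf]
    refine (integral_sub hint (integrable_const μ)).trans ?_
    simp [← hμ]
  rw [integral_map aemeasurable_qf (by fun_prop)] at h
  rwa [Hfun, intervalIntegral.integral_of_le zero_le_one, integral_Ioc_eq_integral_Ioo]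

end Quantile

section Primitive

lemma Hfun_zero (ν : Measure ℝ) (μ : ℝ) : Hfun ν μ 0 = 0 := by simp [Hfun]

variable {ν : Measure ℝ} [IsProbabilityMeasure ν] {μ : ℝ}

lemma Hfun_sub (hint : Integrable id ν) {s t : ℝ} (hs : s ∈ Icc (0 : ℝ) 1)
    (ht : t ∈ Icc (0 : ℝ) 1) : Hfun ν μ t - Hfun ν μ s = ∫ u in s..t, (qf ν u - μ) := by
  have h := intervalIntegrable_qf_sub hint μ
  have h0 : (0 : ℝ) ∈ uIcc (0 : ℝ) 1 := left_mem_uIcc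
  rw [← uIcc_of_le zero_le_one] at hs ht
  exact intervalIntegral.integral_interval_sub_left (h.mono_set (uIcc_subset_uIcc h0 ht))
    (h.mono_set (uIcc_subset_uIcc h0 hs))

lemma intervalIntegrable_qf_sub' (hint : Integrable id ν) {s t : ℝ} (hs : s ∈ Icc (0 : ℝ) 1)
    (ht : t ∈ Icc (0 : ℝ) 1) : IntervalIntegrable (fun u => qf ν u - μ) volume s t := by
  rw [← uIcc_of_le zero_le_one] at hs ht
  exact (intervalIntegrable_qf_sub hint μ).mono_set (uIcc_subset_uIcc hs ht)

lemma Hfun_sub_le (hint : Integrable id ν) {s t M : ℝ} (hs : 0 ≤ s) (hst : s ≤ t) (ht : t ≤ 1)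
    (hM : ∀ u ∈ Ioo s t, qf ν u - μ ≤ M) : Hfun ν μ t - Hfun ν μ s ≤ (t - s) * M := by
  have hs' : s ∈ Icc (0 : ℝ) 1 := ⟨hs, hst.trans ht⟩
  have ht' : t ∈ Icc (0 : ℝ) 1 := ⟨hs.trans hst, ht⟩
  rw [Hfun_sub hint hs' ht']
  have h := intervalIntegral.integral_mono_on_of_le_Ioo hst
    (intervalIntegrable_qf_sub' hint hs' ht') (intervalIntegrable_const (c := M)) hM
  simpa using h

lemma le_Hfun_sub (hint : Integrable id ν) {s t M : ℝ} (hs : 0 ≤ s) (hst : s ≤ t) (ht : t ≤ 1)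
    (hM : ∀ u ∈ Ioo s t, M ≤ qf ν u - μ) : (t - s) * M ≤ Hfun ν μ t - Hfun ν μ s := by
  have hs' : s ∈ Icc (0 : ℝ) 1 := ⟨hs, hst.trans ht⟩
  have ht' : t ∈ Icc (0 : ℝ) 1 := ⟨hs.trans hst, ht⟩
  rw [Hfun_sub hint hs' ht']
  have h := intervalIntegral.integral_mono_on_of_le_Ioo hst
    (intervalIntegrable_const (c := M)) (intervalIntegrable_qf_sub' hint hs' ht') hM
  simpa using h

/-- `H` is convex: it lies below its chords. -/
lemma Hfun_le_chord (hint : Integrable id ν) {a t b : ℝ} (ha : 0 ≤ a) (hat : a ≤ t) (htb : t ≤ b)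
    (hb : b ≤ 1) :
    (b - a) * Hfun ν μ t ≤ (b - t) * Hfun ν μ a + (t - a) * Hfun ν μ b := by
  rcases hat.eq_or_lt with rfl | hat
  · simp
  rcases htb.eq_or_lt with rfl | htb
  · simp
  have ht : t ∈ Ioo (0 : ℝ) 1 := ⟨ha.trans_lt hat, htb.trans_le hb⟩
  have h1 := Hfun_sub_le (μ := μ) hint (M := qf ν t - μ) ha hat.le ht.2.le fun u hu =>
    sub_le_sub_right (qf_monotoneOn ⟨ha.trans_lt hu.1, hu.2.trans ht.2⟩ ht hu.2.le) μ
  have h2 := le_Hfun_sub (μ := μ) hint (M := qf ν t - μ) ht.1.le htb.le hb fun u hu =>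
    sub_le_sub_right (qf_monotoneOn ht ⟨ht.1.trans hu.1, hu.2.trans_le hb⟩ hu.1.le) μ
  nlinarith [mul_le_mul_of_nonneg_left h1 (sub_nonneg.2 htb.le),
    mul_le_mul_of_nonneg_left h2 (sub_nonneg.2 hat.le)]

lemma continuousOn_Hfun (hint : Integrable id ν) : ContinuousOn (Hfun ν μ) (Icc 0 1) := by
  have h := intervalIntegral.continuousOn_primitive_interval'
    (intervalIntegrable_qf_sub hint μ) left_mem_uIcc
  rwa [uIcc_of_le zero_le_one] at h

lemma nuM_mem : nuM ν μ ∈ Icc (0 : ℝ) 1 := ⟨measureReal_nonneg, measureReal_le_one⟩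

lemma nuP_mem : nuP ν μ ∈ Icc (0 : ℝ) 1 := ⟨measureReal_nonneg, measureReal_le_one⟩

lemma nuM_le_nuP : nuM ν μ ≤ nuP ν μ := measureReal_mono Iio_subset_Iic_self

lemma qf_le_of_le_nuP {t : ℝ} (h0 : 0 < t) (h1 : t < 1) (h : t ≤ nuP ν μ) : qf ν t ≤ μ :=
  (qf_le_iff h0 h1).2 h

lemma Hfun_antitone (hint : Integrable id ν) {s t : ℝ} (hs : 0 ≤ s) (hst : s ≤ t)
    (ht : t ≤ nuP ν μ) : Hfun ν μ t ≤ Hfun ν μ s := by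
  have h := Hfun_sub_le (μ := μ) hint (M := 0) hs hst (ht.trans nuP_mem.2) fun u hu =>
    sub_nonpos.2 (qf_le_of_le_nuP (hs.trans_lt hu.1) (hu.2.trans_le (ht.trans nuP_mem.2))
      (hu.2.le.trans ht))
  linarith

lemma Hfun_nuP_le (hint : Integrable id ν) : Hfun ν μ (nuP ν μ) ≤ cval ν μ :=
  Hfun_antitone hint nuM_mem.1 nuM_le_nuP le_rfl

lemma cval_nonpos (hint : Integrable id ν) : cval ν μ ≤ 0 := by
  have h := Hfun_antitone (μ := μ) hint le_rfl nuM_mem.1 nuM_le_nuP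
  rwa [Hfun_zero] at h

end Primitive

section Inverses

variable {ν : Measure ℝ} {μ : ℝ}

lemma bddBelow_Afun_set (s : ℝ) :
    BddBelow {t : ℝ | t ∈ Icc 0 (nuM ν μ) ∧ Hfun ν μ t ≤ s} := ⟨0, fun _ ht => ht.1.1⟩

lemma bddBelow_Bfun_set (s : ℝ) :
    BddBelow {t : ℝ | t ∈ Icc (nuP ν μ) 1 ∧ s ≤ Hfun ν μ t} := ⟨nuP ν μ, fun _ ht => ht.1.1⟩

lemma Bfun_le {s t : ℝ} (hcs : cval ν μ < s) (ht : t ∈ Icc (nuP ν μ) 1)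
    (hst : s ≤ Hfun ν μ t) : Bfun ν μ s ≤ t := by
  rw [Bfun, if_neg hcs.ne']
  exact csInf_le (bddBelow_Bfun_set s) ⟨ht, hst⟩

variable [IsProbabilityMeasure ν]

lemma Bfun_lower_bound (hint : Integrable id ν) (hμ : μ = ∫ x, x ∂ν) {s : ℝ}
    (hcs : cval ν μ < s) (hs : s ≤ 0) : 1 - s / cval ν μ ≤ Bfun ν μ s := by
  have hc := hcs.trans_le hs
  have h1 := Hfun_one hint hμ
  rw [Bfun, if_neg hcs.ne']
  refine le_csInf ⟨1, ⟨nuP_mem.2, le_rfl⟩, by rwa [h1]⟩ ?_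
  rintro t ⟨⟨ht, ht1⟩, hst⟩
  have hchord := Hfun_le_chord (μ := μ) hint nuM_mem.1 (nuM_le_nuP.trans ht) ht1 le_rfl
  rw [h1, mul_zero, add_zero] at hchord
  change _ ≤ _ * cval ν μ at hchord
  have hν : nuM ν μ ∈ Icc (0 : ℝ) 1 := nuM_mem
  suffices h : 1 - t ≤ s / cval ν μ by linarith
  rw [le_div_iff_of_neg hc]
  rcases le_total (Hfun ν μ t) 0 with h | h
  · nlinarith [hν.1]
  · nlinarith [mul_nonneg (sub_nonneg.2 hν.2) h]

lemma nuM_pos (hc : cval ν μ < 0) : 0 < nuM ν μ := by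
  refine nuM_mem.1.lt_of_ne fun h => hc.ne ?_
  rw [cval, ← h, Hfun_zero]

lemma exists_mem_Afun_set (hint : Integrable id ν) {s : ℝ}
    (hcs : cval ν μ < s) (hs : s ≤ 0) :
    nuM ν μ * (s / cval ν μ) ∈ {t : ℝ | t ∈ Icc 0 (nuM ν μ) ∧ Hfun ν μ t ≤ s} := by
  have hc := hcs.trans_le hs
  have hpos := nuM_pos hc
  have hr0 : 0 ≤ s / cval ν μ := div_nonneg_of_nonpos hs hc.le
  have hr1 : s / cval ν μ ≤ 1 := by rw [div_le_one_of_neg hc]; exact hcs.le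
  have hmem : nuM ν μ * (s / cval ν μ) ∈ Icc 0 (nuM ν μ) :=
    ⟨mul_nonneg hpos.le hr0, mul_le_of_le_one_right hpos.le hr1⟩
  refine ⟨hmem, ?_⟩
  have hchord := Hfun_le_chord (μ := μ) hint le_rfl hmem.1 hmem.2 nuM_mem.2
  rw [Hfun_zero, mul_zero, zero_add, sub_zero, sub_zero] at hchord
  change _ ≤ _ * cval ν μ at hchord
  rw [mul_assoc, div_mul_cancel₀ _ hc.ne] at hchord
  exact le_of_mul_le_mul_left hchord hpos

lemma Afun_upper_bound (hint : Integrable id ν) {s : ℝ}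
    (hcs : cval ν μ < s) (hs : s ≤ 0) : Afun ν μ s ≤ s / cval ν μ := by
  rw [Afun, if_neg hcs.ne']
  refine (csInf_le (bddBelow_Afun_set s) (exists_mem_Afun_set hint hcs hs)).trans ?_
  exact mul_le_of_le_one_left (div_nonneg_of_nonpos hs (hcs.trans_le hs).le) nuM_mem.2

lemma Afun_spec (hint : Integrable id ν) {s : ℝ} (hcs : cval ν μ < s) (hs : s ≤ 0) :
    Afun ν μ s ∈ Icc 0 (nuM ν μ) ∧ Hfun ν μ (Afun ν μ s) ≤ s := by
  rw [Afun, if_neg hcs.ne']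
  have hclosed : IsClosed {t : ℝ | t ∈ Icc 0 (nuM ν μ) ∧ Hfun ν μ t ≤ s} :=
    (((continuousOn_Hfun hint).mono (Icc_subset_Icc_right nuM_mem.2)).preimage_isClosed_of_isClosed
      isClosed_Icc isClosed_Iic)
  exact hclosed.csInf_mem ⟨_, exists_mem_Afun_set hint hcs hs⟩ (bddBelow_Afun_set s)

lemma Bfun_spec (hint : Integrable id ν) (hμ : μ = ∫ x, x ∂ν) {s : ℝ}
    (hcs : cval ν μ < s) (hs : s ≤ 0) :
    Bfun ν μ s ∈ Icc (nuP ν μ) 1 ∧ s ≤ Hfun ν μ (Bfun ν μ s) := by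
  rw [Bfun, if_neg hcs.ne']
  have hclosed : IsClosed {t : ℝ | t ∈ Icc (nuP ν μ) 1 ∧ s ≤ Hfun ν μ t} :=
    (((continuousOn_Hfun hint).mono (Icc_subset_Icc_left nuP_mem.1)).preimage_isClosed_of_isClosed
      isClosed_Icc isClosed_Ici)
  exact hclosed.csInf_mem ⟨1, ⟨nuP_mem.2, le_rfl⟩, by rwa [Hfun_one hint hμ]⟩
    (bddBelow_Bfun_set s)

lemma nuP_lt_Bfun (hint : Integrable id ν) (hμ : μ = ∫ x, x ∂ν) {s : ℝ}
    (hcs : cval ν μ < s) (hs : s ≤ 0) : nuP ν μ < Bfun ν μ s := by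
  obtain ⟨h, hle⟩ := Bfun_spec hint hμ hcs hs
  refine h.1.lt_of_ne fun heq => ?_
  rw [← heq] at hle
  exact absurd (hle.trans (Hfun_nuP_le hint)) (not_le.2 hcs)

lemma Bfun_lt_one (hint : Integrable id ν) (hμ : μ = ∫ x, x ∂ν) {s : ℝ}
    (hcs : cval ν μ < s) (hs : s < 0) : Bfun ν μ s < 1 := by
  have hmem : s ∈ Ioo (Hfun ν μ (nuP ν μ)) (Hfun ν μ 1) :=
    ⟨(Hfun_nuP_le hint).trans_lt hcs, by rwa [Hfun_one hint hμ]⟩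
  obtain ⟨t, ht, rfl⟩ := intermediate_value_Ioo nuP_mem.2
    ((continuousOn_Hfun hint).mono (Icc_subset_Icc_left nuP_mem.1)) hmem
  exact (Bfun_le hcs (Ioo_subset_Icc_self ht) le_rfl).trans_lt ht.2

lemma Afun_pos (hint : Integrable id ν) {s : ℝ}
    (hcs : cval ν μ < s) (hs : s < 0) : 0 < Afun ν μ s := by
  obtain ⟨h, hle⟩ := Afun_spec hint hcs hs.le
  refine h.1.lt_of_ne fun heq => ?_
  rw [← heq, Hfun_zero] at hle
  exact absurd hle (not_le.2 hs)

lemma Afun_lt_one (hint : Integrable id ν) {s : ℝ}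
    (hcs : cval ν μ < s) (hs : s < 0) : Afun ν μ s < 1 := by
  refine (Afun_upper_bound hint hcs hs.le).trans_lt ?_
  rw [div_lt_one_of_neg (hcs.trans hs)]
  exact hcs

lemma le_qf_Bfun (hint : Integrable id ν) (hμ : μ = ∫ x, x ∂ν) {s : ℝ}
    (hcs : cval ν μ < s) (hs : s < 0) : μ ≤ qf ν (Bfun ν μ s) := by
  have h := nuP_lt_Bfun hint hμ hcs hs.le
  by_contra! hlt
  exact absurd ((qf_le_iff (nuP_mem.1.trans_lt h) (Bfun_lt_one hint hμ hcs hs)).1 hlt.le)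
    (not_le.2 h)

lemma qf_Afun_le (hint : Integrable id ν) {s : ℝ}
    (hcs : cval ν μ < s) (hs : s < 0) : qf ν (Afun ν μ s) ≤ μ :=
  qf_le_of_le_nuP (Afun_pos hint hcs hs) (Afun_lt_one hint hcs hs)
    ((Afun_spec hint hcs hs.le).1.2.trans nuM_le_nuP)

/-- If `F⁻¹(B(s))` exceeds `y ≥ μ`, then `s` exceeds `H(F(y))`. -/
lemma Hfun_lt_of_lt_qf_Bfun (hint : Integrable id ν) (hμ : μ = ∫ x, x ∂ν) {s y : ℝ}
    (hcs : cval ν μ < s) (hs : s < 0) (hy : μ ≤ y) (h : y < qf ν (Bfun ν μ s)) :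
    Hfun ν μ (ν (Iic y)).toReal < s := by
  by_contra! hle
  have hB := Bfun_le hcs ⟨toReal_Iic_mono hy, measureReal_le_one⟩ hle
  have h0 := nuP_mem.1.trans_lt (nuP_lt_Bfun hint hμ hcs hs.le)
  exact absurd ((qf_le_iff h0 (Bfun_lt_one hint hμ hcs hs)).2 hB) (not_le.2 h)

/-- If `F⁻¹(A(s))` is at most `y < μ`, then `s` is at least `H(F(y))`. -/
lemma Hfun_le_of_qf_Afun_le (hint : Integrable id ν) {s y : ℝ}
    (hcs : cval ν μ < s) (hs : s < 0) (hy : y < μ) (h : qf ν (Afun ν μ s) ≤ y) :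
    Hfun ν μ (ν (Iic y)).toReal ≤ s := by
  have hA := (qf_le_iff (Afun_pos hint hcs hs) (Afun_lt_one hint hcs hs)).1 h
  exact (Hfun_antitone hint (Afun_pos hint hcs hs).le hA (toReal_Iic_mono hy.le)).trans
    (Afun_spec hint hcs hs.le).2

end Inverses

section TailOfK

variable {ν : Measure ℝ} {μ : ℝ}

lemma le_of_le_Kfun {t s : ℝ} (ht : 0 < t) (h : t ≤ Kfun ν μ s) : min (cval ν μ) 0 ≤ s := by
  by_contra! hs
  rw [Kfun, if_neg (hs.trans_le (min_le_right _ _)).le.not_gt,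
    if_pos (hs.trans_le (min_le_left _ _))] at h
  exact absurd h (not_le.2 ht)

lemma Kinv_le {t s : ℝ} (ht : 0 < t) (h : t ≤ Kfun ν μ s) : Kinv ν μ t ≤ s :=
  csInf_le ⟨_, fun _ hs => le_of_le_Kfun ht hs⟩ h

variable [IsProbabilityMeasure ν]

lemma one_sub_Kfun_le (hint : Integrable id ν) (hμ : μ = ∫ x, x ∂ν) (hc : cval ν μ < 0) {s : ℝ}
    (hs : s < 0) : 1 - Kfun ν μ s ≤ 2 * (s / cval ν μ) := by
  rw [Kfun, if_neg hs.le.not_gt]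
  rcases lt_trichotomy s (cval ν μ) with h | h | h
  · have : 1 ≤ s / cval ν μ := by rw [one_le_div_of_neg hc]; exact h.le
    rw [if_pos h]
    linarith
  · have h1 : s / cval ν μ = 1 := by rw [h, div_self hc.ne]
    have h2 : nuM ν μ ≤ nuP ν μ := nuM_le_nuP
    rw [if_neg h.not_lt, if_pos h, h1]
    linarith
  · rw [if_neg h.le.not_gt, if_neg h.ne']
    linarith [Bfun_lower_bound hint hμ h hs.le, Afun_upper_bound hint h hs.le]

lemma Kinv_mem (hint : Integrable id ν) {t : ℝ} (ht : t ∈ Ioo (0 : ℝ) 1) :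
    Kinv ν μ t ∈ Icc (cval ν μ) 0 := by
  have hpos : ∀ s, 0 < s → t ≤ Kfun ν μ s := fun s hs => by
    rw [Kfun, if_pos hs]; exact ht.2.le
  refine ⟨?_, le_of_forall_gt_imp_ge_of_dense fun s hs => Kinv_le ht.1 (hpos s hs)⟩
  refine le_csInf ⟨1, hpos 1 one_pos⟩ fun s hs => ?_
  have h := le_of_le_Kfun ht.1 hs
  rwa [min_eq_left (cval_nonpos hint)] at h

/-- `K` has a tail at `0` that decays at least linearly. -/
lemma volume_le_Kinv_le (hint : Integrable id ν) (hμ : μ = ∫ x, x ∂ν) (hc : cval ν μ < 0) {s : ℝ}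
    (hs : s ≤ 0) :
    volume.restrict (Ioo 0 1) {t | s ≤ Kinv ν μ t} ≤ ENNReal.ofReal (2 * (s / cval ν μ)) := by
  have hbound : ∀ r < s, volume.restrict (Ioo 0 1) {t | s ≤ Kinv ν μ t} ≤
      ENNReal.ofReal (2 * (r / cval ν μ)) := fun r hr => by
    rw [Measure.restrict_apply' measurableSet_Ioo]
    have hsub : {t | s ≤ Kinv ν μ t} ∩ Ioo 0 1 ⊆ Ioo (Kfun ν μ r) 1 := fun t ⟨hst, ht⟩ => by
      refine ⟨?_, ht.2⟩
      by_contra! h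
      exact absurd (hst.trans (Kinv_le ht.1 h)) (not_le.2 hr)
    refine (measure_mono hsub).trans ?_
    rw [Real.volume_Ioo]
    exact ENNReal.ofReal_le_ofReal (one_sub_Kfun_le hint hμ hc (hr.trans_le hs))
  have hlim : Tendsto (fun r => ENNReal.ofReal (2 * (r / cval ν μ))) (𝓝[<] s)
      (𝓝 (ENNReal.ofReal (2 * (s / cval ν μ)))) :=
    ((ENNReal.continuous_ofReal.comp (by fun_prop)).tendsto s).mono_left nhdsWithin_le_nhds
  exact ge_of_tendsto hlim (eventually_mem_nhdsWithin.mono hbound)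

end TailOfK

section Moment

variable {ν : Measure ℝ} {μ : ℝ}

/-- Lebesgue measure on `(0, 1)` weighted by `|F⁻¹ - μ|`. -/
noncomputable def deviationMeasure (ν : Measure ℝ) (μ : ℝ) : Measure ℝ :=
  (volume.restrict (Ioo 0 1)).withDensity fun t => ‖qf ν t - μ‖ₑ

lemma setLIntegral_le_deviationMeasure {S T : Set ℝ} (hST : T ⊆ S) (hT : T ⊆ Ioo 0 1) :
    ∫⁻ t in T, ‖qf ν t - μ‖ₑ ≤ deviationMeasure ν μ S := by
  refine le_trans ?_ (withDensity_apply_le _ S)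
  rw [Measure.restrict_restrict' measurableSet_Ioo]
  exact lintegral_mono_set (subset_inter hST hT)

variable [IsProbabilityMeasure ν]

lemma aemeasurable_qf_sub : AEMeasurable (fun t => qf ν t - μ) (volume.restrict (Ioo 0 1)) :=
  aemeasurable_qf.sub_const μ

/-- `|H(F(y))|` is bounded by the weighted measure of the quantiles above `y`. -/
lemma enorm_Hfun_le_upper (hint : Integrable id ν) (hμ : μ = ∫ x, x ∂ν) (y : ℝ) :
    ‖Hfun ν μ (ν (Iic y)).toReal‖ₑ ≤ deviationMeasure ν μ {t | y ≤ qf ν t} := by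
  have hp : (ν (Iic y)).toReal ∈ Icc (0 : ℝ) 1 := ⟨measureReal_nonneg, measureReal_le_one⟩
  have h := Hfun_sub (μ := μ) hint hp (right_mem_Icc.2 zero_le_one)
  rw [Hfun_one hint hμ, zero_sub, intervalIntegral.integral_of_le hp.2,
    integral_Ioc_eq_integral_Ioo] at h
  rw [← enorm_neg, h]
  refine (enorm_integral_le_lintegral_enorm _).trans (setLIntegral_le_deviationMeasure ?_ ?_)
  · intro t ht
    change y ≤ qf ν t
    by_contra! hlt
    exact absurd ((qf_le_iff (hp.1.trans_lt ht.1) ht.2).1 hlt.le) (not_le.2 ht.1)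
  · exact Ioo_subset_Ioo_left hp.1

/-- `|H(F(y))|` is bounded by the weighted measure of the quantiles below `y`. -/
lemma enorm_Hfun_le_lower (y : ℝ) :
    ‖Hfun ν μ (ν (Iic y)).toReal‖ₑ ≤ deviationMeasure ν μ {t | qf ν t ≤ y} := by
  have hp : (ν (Iic y)).toReal ∈ Icc (0 : ℝ) 1 := ⟨measureReal_nonneg, measureReal_le_one⟩
  rw [Hfun, intervalIntegral.integral_of_le hp.1, integral_Ioc_eq_integral_Ioo]
  refine (enorm_integral_le_lintegral_enorm _).trans (setLIntegral_le_deviationMeasure ?_ ?_)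
  · exact fun t ht => (qf_le_iff ht.1 (ht.2.trans_le hp.2)).2 ht.2.le
  · exact Ioo_subset_Ioo_right hp.2

lemma volume_le_Kinv_le_enorm (hint : Integrable id ν) (hμ : μ = ∫ x, x ∂ν) (hc : cval ν μ < 0)
    {p : ℝ} (hp : p ∈ Icc (0 : ℝ) 1) :
    volume.restrict (Ioo 0 1) {t | Hfun ν μ p ≤ Kinv ν μ t} ≤
      ENNReal.ofReal (2 / -cval ν μ) * ‖Hfun ν μ p‖ₑ := by
  have hH : Hfun ν μ p ≤ 0 := by
    have h := Hfun_le_chord (μ := μ) hint le_rfl hp.1 hp.2 le_rfl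
    simpa [Hfun_zero, Hfun_one hint hμ] using h
  refine (volume_le_Kinv_le hint hμ hc hH).trans_eq ?_
  rw [Real.enorm_eq_ofReal_abs, abs_of_nonpos hH, ← ENNReal.ofReal_mul]
  · congr 1
    field_simp
  · exact div_nonneg zero_le_two (neg_nonneg.2 hc.le)

lemma residualRV_eq_zero_or (hint : Integrable id ν) {t : ℝ} (ht : t ∈ Ioo (0 : ℝ) 1) :
    residualRV ν μ t = 0 ∨ cval ν μ < Kinv ν μ t := by
  rcases (Kinv_mem (μ := μ) hint ht).1.eq_or_lt with h | h
  · left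
    simp [residualRV, ← h, Bfun, Afun]
  · exact Or.inr h

/-- The tail of the residual distribution is controlled by the weighted tail of `F`. -/
lemma volume_lt_abs_residualRV_le (hint : Integrable id ν) (hμ : μ = ∫ x, x ∂ν)
    (hc : cval ν μ < 0) {x : ℝ} (hx : 0 < x) :
    volume.restrict (Ioo 0 1) {t | x < |residualRV ν μ t|} ≤
      ENNReal.ofReal (2 / -cval ν μ) * 2 * deviationMeasure ν μ {t | x ≤ 2 * |qf ν t - μ|} := by
  set m := volume.restrict (Ioo (0 : ℝ) 1)
  set C := ENNReal.ofReal (2 / -cval ν μ)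
  set D := deviationMeasure ν μ {t | x ≤ 2 * |qf ν t - μ|}
  set p := (ν (Iic (μ + x / 2))).toReal
  set q := (ν (Iic (μ - x / 2))).toReal
  have hp : p ∈ Icc (0 : ℝ) 1 := ⟨measureReal_nonneg, measureReal_le_one⟩
  have hq : q ∈ Icc (0 : ℝ) 1 := ⟨measureReal_nonneg, measureReal_le_one⟩
  have h0 : m {t | 0 ≤ Kinv ν μ t} = 0 := by
    have h := volume_le_Kinv_le (μ := μ) hint hμ hc le_rfl
    rwa [zero_div, mul_zero, ENNReal.ofReal_zero, nonpos_iff_eq_zero] at h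
  have hP : m {t | Hfun ν μ p ≤ Kinv ν μ t} ≤ C * D := by
    refine (volume_le_Kinv_le_enorm hint hμ hc hp).trans ?_
    gcongr
    refine (enorm_Hfun_le_upper hint hμ _).trans (measure_mono fun t ht => ?_)
    change μ + x / 2 ≤ qf ν t at ht
    change x ≤ 2 * |qf ν t - μ|
    linarith [le_abs_self (qf ν t - μ)]
  have hQ : m {t | Hfun ν μ q ≤ Kinv ν μ t} ≤ C * D := by
    refine (volume_le_Kinv_le_enorm hint hμ hc hq).trans ?_
    gcongr
    refine (enorm_Hfun_le_lower _).trans (measure_mono fun t ht => ?_)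
    change qf ν t ≤ μ - x / 2 at ht
    change x ≤ 2 * |qf ν t - μ|
    linarith [neg_le_abs (qf ν t - μ)]
  have hsub : {t | x < |residualRV ν μ t|} ∩ Ioo 0 1 ⊆ {t | 0 ≤ Kinv ν μ t} ∪
      ({t | Hfun ν μ p ≤ Kinv ν μ t} ∪ {t | Hfun ν μ q ≤ Kinv ν μ t}) := by
    rintro t ⟨hxt, ht⟩
    change x < |residualRV ν μ t| at hxt
    rcases residualRV_eq_zero_or (μ := μ) hint ht with h | h
    · rw [h, abs_zero] at hxt
      exact absurd hxt hx.not_gt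
    rcases le_or_gt 0 (Kinv ν μ t) with hY | hY
    · exact Or.inl hY
    have hb := le_qf_Bfun hint hμ h hY
    have ha := qf_Afun_le hint h hY
    rw [residualRV, abs_of_nonneg (by linarith)] at hxt
    rcases lt_or_ge (μ + x / 2) (qf ν (Bfun ν μ (Kinv ν μ t))) with hB | hB
    · exact Or.inr (Or.inl (Hfun_lt_of_lt_qf_Bfun hint hμ h hY (by linarith) hB).le)
    · exact Or.inr (Or.inr (Hfun_le_of_qf_Afun_le hint h hY (by linarith) (by linarith)))
  calc m {t | x < |residualRV ν μ t|} = m ({t | x < |residualRV ν μ t|} ∩ Ioo 0 1) := by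
        simp only [m, Measure.restrict_apply' measurableSet_Ioo, inter_assoc, inter_self]
    _ ≤ 0 + (C * D + C * D) := (measure_mono hsub).trans <| (measure_union_le _ _).trans <|
        add_le_add h0.le ((measure_union_le _ _).trans (add_le_add hP hQ))
    _ = C * 2 * D := by ring

lemma lintegral_deviationMeasure_lt_top {k : ℝ} (hk : 1 < k)
    (hmom : Integrable (fun x : ℝ => |x| ^ k) ν) :
    ∫⁻ t, ENNReal.ofReal ((2 * |qf ν t - μ|) ^ (k - 1)) ∂deviationMeasure ν μ < ⊤ := by
  have hk0 : 0 < k := one_pos.trans hk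
  have hp0 : ENNReal.ofReal k ≠ 0 := by simpa using hk0
  have hkr : (ENNReal.ofReal k).toReal = k := ENNReal.toReal_ofReal hk0.le
  have hmem : MemLp (fun x : ℝ => x) (ENNReal.ofReal k) ν := by
    rw [← integrable_norm_rpow_iff (by fun_prop) hp0 ENNReal.ofReal_ne_top, hkr]
    simpa only [Real.norm_eq_abs] using hmom
  have hdev : Integrable (fun x : ℝ => |x - μ| ^ k) ν := by
    have h := (integrable_norm_rpow_iff (by fun_prop) hp0 ENNReal.ofReal_ne_top).2
      (hmem.sub (memLp_const μ))
    rw [hkr] at h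
    simpa only [Real.norm_eq_abs, Pi.sub_apply] using h
  have hq : Integrable (fun t => |qf ν t - μ| ^ k) (volume.restrict (Ioo 0 1)) := by
    rw [← map_qf (ν := ν)] at hdev
    exact hdev.comp_aemeasurable aemeasurable_qf
  have hmeas := aemeasurable_qf_sub (ν := ν) (μ := μ)
  have hpow : AEMeasurable (fun t => ENNReal.ofReal ((2 * |qf ν t - μ|) ^ (k - 1)))
      (volume.restrict (Ioo 0 1)) :=
    (((continuous_abs.measurable.comp_aemeasurable hmeas).const_mul 2).pow_const
      (k - 1)).ennreal_ofReal
  rw [deviationMeasure, lintegral_withDensity_eq_lintegral_mul₀ hmeas.enorm hpow]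
  refine lt_of_eq_of_lt (lintegral_congr fun t => ?_) (hq.const_mul (2 ^ (k - 1))).lintegral_lt_top
  have ha : 0 ≤ |qf ν t - μ| := abs_nonneg _
  rw [Pi.mul_apply, Real.enorm_eq_ofReal_abs, ← ENNReal.ofReal_mul ha, Real.mul_rpow zero_le_two ha]
  congr 1
  rcases ha.eq_or_lt with h | h
  · rw [← h, Real.zero_rpow hk0.ne']
    ring
  · rw [Real.rpow_sub_one h.ne']
    field_simp

lemma lintegral_residualRV_lt_top (hint : Integrable id ν) (hμ : μ = ∫ x, x ∂ν) {k : ℝ}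
    (hk : 1 < k) (hmom : Integrable (fun x : ℝ => |x| ^ k) ν)
    (hmeas : AEMeasurable (residualRV ν μ) (volume.restrict (Ioo 0 1))) :
    ∫⁻ t in Ioo 0 1, ENNReal.ofReal (|residualRV ν μ t| ^ (k - 1)) < ⊤ := by
  have hk1 : 0 < k - 1 := sub_pos.2 hk
  rcases (cval_nonpos (μ := μ) hint).lt_or_eq with hc | hc
  · have hdevmeas : AEMeasurable (fun t => 2 * |qf ν t - μ|) (deviationMeasure ν μ) :=
      ((continuous_abs.measurable.comp_aemeasurable aemeasurable_qf_sub).const_mul 2).mono_ac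
        (withDensity_absolutelyContinuous _ _)
    have hfin := lintegral_deviationMeasure_lt_top (μ := μ) hk hmom
    rw [lintegral_rpow_eq_lintegral_meas_le_mul _ (ae_of_all _ fun t => by positivity)
      hdevmeas hk1] at hfin
    rw [lintegral_rpow_eq_lintegral_meas_lt_mul _ (ae_of_all _ fun t => abs_nonneg _)
      (continuous_abs.measurable.comp_aemeasurable hmeas) hk1]
    set C := ENNReal.ofReal (2 / -cval ν μ) * 2
    have hC : C ≠ ⊤ := ENNReal.mul_ne_top ENNReal.ofReal_ne_top ENNReal.ofNat_ne_top
    refine lt_of_le_of_lt ?_ (ENNReal.mul_lt_top hC.lt_top hfin)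
    rw [mul_left_comm, ← lintegral_const_mul' _ _ hC]
    gcongr ENNReal.ofReal (k - 1) * ?_
    refine setLIntegral_mono' measurableSet_Ioi fun x hx => ?_
    rw [← mul_assoc]
    gcongr
    exact volume_lt_abs_residualRV_le hint hμ hc hx
  · have hzero : ∀ t ∈ Ioo (0 : ℝ) 1, ENNReal.ofReal (|residualRV ν μ t| ^ (k - 1)) = 0 := by
      intro t ht
      have h := (residualRV_eq_zero_or (μ := μ) hint ht).resolve_right
        (by rw [hc]; exact (Kinv_mem hint ht).2.not_gt)
      rw [h, abs_zero, Real.zero_rpow hk1.ne', ENNReal.ofReal_zero]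
    rw [setLIntegral_congr_fun measurableSet_Ioo hzero]
    simp

end Moment

/-- **Lemma 2.2.** If `F` has finite `k`-th absolute moment for some `k > 1`, then the
residual distribution `F̃` of `F` has finite `(k−1)`-st absolute moment. -/
theorem residual_moment
    (ν : Measure ℝ) [IsProbabilityMeasure ν] (μ : ℝ) (k : ℝ) (hk : 1 < k)
    (hmom : Integrable (fun x : ℝ => |x| ^ k) ν)
    (hint : Integrable id ν) (hμ : μ = ∫ x, x ∂ν) :
    Integrable (fun z : ℝ => |z| ^ (k - 1)) (residualDist ν μ) := by
  have hIoo : volume.restrict (Icc (0 : ℝ) 1) = volume.restrict (Ioo 0 1) :=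
    Measure.restrict_congr_set Ioo_ae_eq_Icc.symm
  rw [residualDist, hIoo]
  by_cases hmeas : AEMeasurable (residualRV ν μ) (volume.restrict (Ioo 0 1))
  · have hcont : Continuous fun z : ℝ => |z| ^ (k - 1) :=
      continuous_abs.rpow_const fun _ => Or.inr (sub_pos.2 hk).le
    rw [integrable_map_measure hcont.aestronglyMeasurable hmeas]
    refine ⟨(hcont.measurable.comp_aemeasurable hmeas).aestronglyMeasurable, ?_⟩
    refine (hasFiniteIntegral_iff_ofReal
      (ae_of_all _ fun t => Real.rpow_nonneg (abs_nonneg _) _)).2 ?_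
    exact lintegral_residualRV_lt_top hint hμ hk hmom hmeas
  · rw [Measure.map_of_not_aemeasurable hmeas]
    exact integrable_zero_measure
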